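/- For every real number r with 0 < r < 1, B(r, 1 − r) · B(1/2, r)² · 4F3(r, r, 1/2, 1/2; 1, r + 1/2, r + 1/2; −1) = 2^{−2r} · B((1 − r)/2, r) · B(1/2, 1/2) · B(1 − r/2, r) · 3F2(1/2, 1/2, 1 − r/2; 1, 1 + r/2; 1). (Both series converge absolutely under these hypotheses.) -/

import Mathlib

open Real

/-- Ascending Pochhammer symbol `(x)_k = x(x+1)⋯(x+k−1)`. -/
noncomputable def poch (x : ℝ) (k : ℕ) : ℝ := (ascPochhammer ℝ k).eval x

/-- The Beta function quotient `B(x,y) = Γ(x)Γ(y)/Γ(x+y)`. -/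
noncomputable def betaR (x y : ℝ) : ℝ := Gamma x * Gamma y / Gamma (x + y)

/-- Generalized hypergeometric series `₃F₂(a₁,a₂,a₃; b₁,b₂; z)`. -/
noncomputable def F32 (a1 a2 a3 b1 b2 z : ℝ) : ℝ :=
  ∑' k : ℕ, (poch a1 k * poch a2 k * poch a3 k)
      / (poch b1 k * poch b2 k * (k.factorial : ℝ)) * z ^ k

/-- The hypergeometric period value `P(r,s) = π · B(r, s−r) · ₃F₂(1/2,1/2,r; 1,s; 1)`. -/
noncomputable def P (r s : ℝ) : ℝ := π * betaR r (s - r) * F32 (1/2) (1/2) r 1 s 1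

/-- Generalized hypergeometric series `₄F₃(a₁,a₂,a₃,a₄; b₁,b₂,b₃; z)`. -/
noncomputable def F43 (a1 a2 a3 a4 b1 b2 b3 z : ℝ) : ℝ :=
  ∑' k : ℕ, (poch a1 k * poch a2 k * poch a3 k * poch a4 k)
      / (poch b1 k * poch b2 k * poch b3 k * (k.factorial : ℝ)) * z ^ k

open Filter Topology in
/-- A Raabe-type test. -/
lemma summable_and_tendsto_of_raabe {f : ℕ → ℝ} (hf : ∀ n, 0 ≤ f n) {ε : ℝ} (hε : 0 < ε) {N : ℕ}
    (h : ∀ n, N ≤ n → ε * f n ≤ n * f n - (n + 1) * f (n + 1)) :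
    Summable f ∧ Tendsto (fun n : ℕ => n * f n) atTop (𝓝 0) := by
  have hsum : Summable f := by
    rw [← summable_nat_add_iff N]
    refine summable_of_sum_range_le (c := N * f N / ε) (fun n => hf _) fun n => ?_
    rw [le_div_iff₀ hε]
    have key : (∑ i ∈ Finset.range n, f (i + N)) * ε
        ≤ N * f N - ((n + N : ℕ) : ℝ) * f (n + N) := by
      induction n with
      | zero => simp
      | succ n ih =>
        rw [Finset.sum_range_succ, show n + 1 + N = n + N + 1 by ring]
        have := h (n + N) (by lia)
        push_cast at *
        linarith
    have : 0 ≤ ((n + N : ℕ) : ℝ) * f (n + N) := mul_nonneg (by positivity) (hf _)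
    linarith
  refine ⟨hsum, ?_⟩
  have hanti : Antitone fun n : ℕ => ((n + N : ℕ) : ℝ) * f (n + N) := by
    refine antitone_nat_of_succ_le fun n => ?_
    have h1 := h (n + N) (by lia)
    have h2 := mul_nonneg hε.le (hf (n + N))
    rw [show n + 1 + N = n + N + 1 by ring]
    push_cast at *
    linarith
  have hbdd : BddBelow (Set.range fun n : ℕ => ((n + N : ℕ) : ℝ) * f (n + N)) :=
    ⟨0, by rintro _ ⟨n, rfl⟩; exact mul_nonneg (by positivity) (hf _)⟩
  have hlim := tendsto_atTop_ciInf hanti hbdd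
  set L := ⨅ n : ℕ, ((n + N : ℕ) : ℝ) * f (n + N) with hL
  have hL0 : 0 ≤ L := ge_of_tendsto' hlim fun n => mul_nonneg (by positivity) (hf _)
  have hLz : L = 0 := by
    by_contra hne
    have hpos : 0 < L := lt_of_le_of_ne hL0 (Ne.symm hne)
    have hharm : Summable fun n : ℕ => L * (1 / ((n + (N + 1) : ℕ) : ℝ)) := by
      refine Summable.of_nonneg_of_le (fun n => by positivity) (fun n => ?_)
        ((summable_nat_add_iff (N + 1)).2 hsum)
      have := ciInf_le hbdd (n + 1)
      rw [← hL, show n + 1 + N = n + (N + 1) by ring] at this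
      rw [mul_one_div, div_le_iff₀ (by positivity), mul_comm]
      exact this
    rw [summable_mul_left_iff hpos.ne'] at hharm
    exact Real.not_summable_one_div_natCast
      ((summable_nat_add_iff (f := fun n : ℕ => 1 / (n : ℝ)) (N + 1)).1 hharm)
  rw [hLz] at hlim
  exact (tendsto_add_atTop_iff_nat N).1 hlim

lemma poch_zero (x : ℝ) : poch x 0 = 1 := by simp [poch]

lemma poch_succ (x : ℝ) (k : ℕ) : poch x (k + 1) = poch x k * (x + k) :=
  ascPochhammer_succ_eval k x

lemma poch_pos {x : ℝ} (hx : 0 < x) (k : ℕ) : 0 < poch x k := ascPochhammer_pos k x hx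

lemma poch_add (x : ℝ) (m n : ℕ) : poch x (m + n) = poch x m * poch (x + m) n := by
  induction n with
  | zero => simp [poch_zero]
  | succ n ih => rw [← add_assoc, poch_succ, ih, poch_succ]; push_cast; ring

lemma poch_one (k : ℕ) : poch 1 k = k.factorial := by
  simp [poch, ascPochhammer_eval_one]

lemma poch_eq_prod (x : ℝ) (k : ℕ) : poch x k = ∏ j ∈ Finset.range k, (x + j) := by
  induction k with
  | zero => simp [poch_zero]
  | succ k ih => rw [poch_succ, ih, Finset.prod_range_succ]

lemma poch_succ_mul_le {c x : ℝ} (hc : 0 < c) (hx : c ≤ x) (n : ℕ) :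
    poch c (n + 1) * x ≤ poch x (n + 1) * c := by
  induction n with
  | zero => simp [poch_succ, poch_zero, mul_comm]
  | succ n ih =>
    have h1 := (poch_pos (hc.trans_le hx) (n + 1)).le
    rw [poch_succ _ (n + 1), poch_succ _ (n + 1)]
    calc poch c (n + 1) * (c + (n + 1 : ℕ)) * x
        = (poch c (n + 1) * x) * (c + (n + 1 : ℕ)) := by ring
      _ ≤ (poch x (n + 1) * c) * (x + (n + 1 : ℕ)) := by gcongr
      _ = _ := by ring

lemma Gamma_add_natCast {x : ℝ} (hx : 0 < x) (k : ℕ) :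
    Gamma (x + k) = poch x k * Gamma x := by
  induction k with
  | zero => simp [poch_zero]
  | succ k ih =>
    push_cast
    rw [← add_assoc, Gamma_add_one (by positivity), ih, poch_succ]
    ring

lemma gammaSeq_eq (x : ℝ) (n : ℕ) :
    Real.GammaSeq x n = (n : ℝ) ^ x * n.factorial / poch x (n + 1) := by
  rw [Real.GammaSeq, poch_eq_prod]

/-- The general term of `₂F₁(a, b; c; 1)`. -/
noncomputable def gaussTerm (a b c : ℝ) (n : ℕ) : ℝ :=
  poch a n * poch b n / (n.factorial * poch c n)

section Gauss

variable {a b c : ℝ}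

lemma gaussTerm_pos (ha : 0 < a) (hb : 0 < b) (hc : 0 < c) (n : ℕ) : 0 < gaussTerm a b c n := by
  have := poch_pos ha n
  have := poch_pos hb n
  have := poch_pos hc n
  unfold gaussTerm
  positivity

lemma gaussTerm_succ (hc : 0 < c) (n : ℕ) :
    (n + 1) * gaussTerm a b c (n + 1) = gaussTerm a b c n * ((a + n) * (b + n) / (c + n)) := by
  have := (poch_pos hc n).ne'
  have : c + n ≠ 0 := by positivity
  simp only [gaussTerm, poch_succ, Nat.factorial_succ]
  push_cast
  field_simp

lemma gaussTerm_shift (hc : 0 < c) (n : ℕ) :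
    gaussTerm a b (c + 1) n = gaussTerm a b c n * (c / (c + n)) := by
  have h : poch (c + 1) n = poch c n * (c + n) / c := by
    rw [eq_div_iff hc.ne', ← poch_succ, add_comm n 1, poch_add]
    simp [poch_succ, poch_zero, mul_comm]
  have := (poch_pos hc n).ne'
  have : c + n ≠ 0 := by positivity
  simp only [gaussTerm, h]
  field_simp

open Filter Topology in
lemma gaussTerm_summable_and_tendsto (ha : 0 < a) (hb : 0 < b) (hab : a + b < c) :
    Summable (gaussTerm a b c) ∧ Tendsto (fun n : ℕ => n * gaussTerm a b c n) atTop (𝓝 0) := by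
  have hc : 0 < c := by linarith
  have hs : 0 < c - a - b := by linarith
  refine summable_and_tendsto_of_raabe (fun n => (gaussTerm_pos ha hb hc n).le)
    (half_pos hs) (N := ⌈c + 2 * (a * b) / (c - a - b)⌉₊) fun n hn => ?_
  have hn' : c + 2 * (a * b) / (c - a - b) ≤ n := (Nat.le_ceil _).trans (by exact_mod_cast hn)
  have hn2 : (c - a - b) * c + 2 * (a * b) ≤ (c - a - b) * n := by
    have := mul_le_mul_of_nonneg_left hn' hs.le
    rwa [mul_add, mul_div_cancel₀ _ hs.ne'] at this
  rw [gaussTerm_succ hc, mul_comm, mul_comm (n : ℝ), ← mul_sub]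
  refine mul_le_mul_of_nonneg_left ?_ (gaussTerm_pos ha hb hc n).le
  have hcn : 0 < c + n := by positivity
  rw [le_sub_iff_add_le, ← le_sub_iff_add_le', div_le_iff₀ hcn]
  nlinarith

lemma tsum_gaussTerm_contiguous (ha : 0 < a) (hb : 0 < b) (hab : a + b < c) :
    c * (c - a - b) * ∑' n, gaussTerm a b c n
      = (c - a) * (c - b) * ∑' n, gaussTerm a b (c + 1) n := by
  have hc : 0 < c := by linarith
  obtain ⟨hs, ht⟩ := gaussTerm_summable_and_tendsto ha hb hab
  have hs' := (gaussTerm_summable_and_tendsto ha hb (by linarith : a + b < c + 1)).1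
  have h1 := (hs.hasSum.mul_left (c * (c - a - b))).sub (hs'.hasSum.mul_left ((c - a) * (c - b)))
  have h2 : HasSum (fun n => c * (c - a - b) * gaussTerm a b c n
      - (c - a) * (c - b) * gaussTerm a b (c + 1) n) 0 := by
    have hsum := h1.summable
    rw [hsum.hasSum_iff_tendsto_nat]
    have : ∀ n : ℕ, ∑ i ∈ Finset.range n, (c * (c - a - b) * gaussTerm a b c i
      - (c - a) * (c - b) * gaussTerm a b (c + 1) i) = -c * (n * gaussTerm a b c n) := by
      intro n
      induction n with
      | zero => simp
      | succ n ih =>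
        have hcn : c + n ≠ 0 := by positivity
        rw [Finset.sum_range_succ, ih]
        push_cast
        rw [gaussTerm_succ hc, gaussTerm_shift hc]
        field_simp
        ring
    simp only [this]
    simpa using ht.const_mul (-c)
  linarith [h1.unique h2]

lemma tsum_gaussTerm_iterate (ha : 0 < a) (hb : 0 < b) (hab : a + b < c) (m : ℕ) :
    poch c m * poch (c - a - b) m * ∑' n, gaussTerm a b c n
      = poch (c - a) m * poch (c - b) m * ∑' n, gaussTerm a b (c + m) n := by
  induction m with
  | zero => simp [poch_zero]
  | succ m ih =>
    have hm : (0 : ℝ) ≤ m := by positivity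
    have h := tsum_gaussTerm_contiguous ha hb (by linarith : a + b < c + m)
    simp only [poch_succ]
    push_cast
    rw [← add_assoc]
    calc _ = (poch c m * poch (c - a - b) m * ∑' n, gaussTerm a b c n)
          * ((c + m) * (c + m - a - b)) := by ring
      _ = poch (c - a) m * poch (c - b) m
          * ((c + m) * (c + m - a - b) * ∑' n, gaussTerm a b (c + m) n) := by rw [ih]; ring
      _ = _ := by rw [h]; ring

open Filter Topology in
lemma tendsto_tsum_gaussTerm (ha : 0 < a) (hb : 0 < b) (hab : a + b < c) :
    Tendsto (fun m : ℕ => ∑' n, gaussTerm a b (c + m) n) atTop (𝓝 1) := by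
  have hc : 0 < c := by linarith
  have hs := (gaussTerm_summable_and_tendsto ha hb hab).1
  have hs' (m : ℕ) := (gaussTerm_summable_and_tendsto ha hb
    (show a + b < c + m by linarith [(Nat.cast_nonneg m : (0 : ℝ) ≤ m)])).1
  have hupper : Tendsto (fun m : ℕ => 1 + c / (c + m) * ∑' n, gaussTerm a b c n) atTop (𝓝 1) := by
    have h : Tendsto (fun m : ℕ => c / (c + m)) atTop (𝓝 0) :=
      tendsto_const_nhds.div_atTop (tendsto_atTop_add_const_left _ _ tendsto_natCast_atTop_atTop)
    simpa using (h.mul_const (∑' n, gaussTerm a b c n)).const_add 1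
  have hzero (x : ℝ) : gaussTerm a b x 0 = 1 := by simp [gaussTerm, poch_zero]
  refine tendsto_of_tendsto_of_tendsto_of_le_of_le tendsto_const_nhds hupper
    (fun m => ?_) (fun m => ?_)
  · have := (hs' m).le_tsum 0 fun n _ => (gaussTerm_pos ha hb (by positivity) n).le
    rwa [hzero] at this
  · have hδ : HasSum (fun n : ℕ => if n = 0 then (1 : ℝ) else 0) 1 := hasSum_ite_eq 0 1
    refine hasSum_le (fun n => ?_) (hs' m).hasSum (hδ.add (hs.hasSum.mul_left (c / (c + m))))
    rcases n with _ | n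
    · simp only [hzero, if_true]
      have : 0 ≤ c / (c + m) := by positivity
      linarith
    · have hcm : 0 < c + m := by positivity
      have h := poch_succ_mul_le hc (by linarith [(Nat.cast_nonneg m : (0 : ℝ) ≤ m)] : c ≤ c + m) n
      have h1 := poch_pos hc (n + 1)
      have h2 := poch_pos hcm (n + 1)
      have h3 := poch_pos ha (n + 1)
      have h4 := poch_pos hb (n + 1)
      simp only [gaussTerm, Nat.add_eq_zero_iff, one_ne_zero, and_false, if_false, zero_add]
      rw [div_mul_div_comm, div_le_div_iff₀ (by positivity) (by positivity)]
      have := mul_le_mul_of_nonneg_left h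
        (by positivity : 0 ≤ poch a (n + 1) * poch b (n + 1) * (n + 1).factorial)
      linarith

open Filter Topology in
/-- Gauss's summation theorem for `₂F₁(a, b; c; 1)`. -/
lemma hasSum_gaussTerm (ha : 0 < a) (hb : 0 < b) (hab : a + b < c) :
    HasSum (gaussTerm a b c)
      (Gamma c * Gamma (c - a - b) / (Gamma (c - a) * Gamma (c - b))) := by
  convert (gaussTerm_summable_and_tendsto ha hb hab).1.hasSum
  have hc : 0 < c := by linarith
  have hca : 0 < c - a := by linarith
  have hcb : 0 < c - b := by linarith
  have hs : 0 < c - a - b := by linarith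
  have hlim : Tendsto (fun n : ℕ => Real.GammaSeq c n * Real.GammaSeq (c - a - b) n
      / (Real.GammaSeq (c - a) n * Real.GammaSeq (c - b) n)
      * ∑' k, gaussTerm a b (c + (n + 1 : ℕ)) k) atTop
      (𝓝 (Gamma c * Gamma (c - a - b) / (Gamma (c - a) * Gamma (c - b)) * 1)) :=
    (((Real.GammaSeq_tendsto_Gamma _).mul (Real.GammaSeq_tendsto_Gamma _)).div
      ((Real.GammaSeq_tendsto_Gamma _).mul (Real.GammaSeq_tendsto_Gamma _))
      (mul_pos (Gamma_pos_of_pos hca) (Gamma_pos_of_pos hcb)).ne').mul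
      ((tendsto_add_atTop_iff_nat 1).2 (tendsto_tsum_gaussTerm ha hb hab))
  rw [mul_one] at hlim
  refine tendsto_nhds_unique hlim (tendsto_const_nhds.congr' ?_)
  filter_upwards [eventually_gt_atTop 0] with n hn
  have hn' : (0 : ℝ) < n := by exact_mod_cast hn
  have hpow : (n : ℝ) ^ c * (n : ℝ) ^ (c - a - b) = (n : ℝ) ^ (c - a) * (n : ℝ) ^ (c - b) := by
    rw [← rpow_add hn', ← rpow_add hn']
    ring_nf
  have h := tsum_gaussTerm_iterate ha hb hab (n + 1)
  have h1 := poch_pos hc (n + 1)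
  have h2 := poch_pos hca (n + 1)
  have h3 := poch_pos hcb (n + 1)
  have h4 := poch_pos hs (n + 1)
  have h5 := rpow_pos_of_pos hn' (c - a)
  have h6 := rpow_pos_of_pos hn' (c - b)
  simp only [gammaSeq_eq]
  rw [div_mul_div_comm, div_mul_div_comm, div_div_div_eq]
  rw [div_mul_eq_mul_div, eq_div_iff (by positivity)]
  linear_combination ((n : ℝ) ^ (c - a) * (n : ℝ) ^ (c - b) * n.factorial ^ 2) * h
    - (n.factorial ^ 2 * poch (c - a) (n + 1) * poch (c - b) (n + 1)
      * ∑' k, gaussTerm a b (c + (n + 1 : ℕ)) k) * hpow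

end Gauss

/-- A terminating form of Dixon's theorem. -/
lemma dixon_terminating {r : ℝ} (hr : 0 < r) (n : ℕ) :
    ∑ k ∈ Finset.range (n + 1), (-1) ^ k * poch r k ^ 2
        / (k.factorial ^ 2 * (n - k).factorial * poch (1 + r) (n + k))
      = poch (1 - r / 2) n / (n.factorial ^ 2 * poch (1 + r / 2) n) := by
  set F : ℕ → ℕ → ℝ := fun n k => (-1) ^ k * poch r k ^ 2
    / (k.factorial ^ 2 * (n - k).factorial * poch (1 + r) (n + k)) with hF
  have hp (k : ℕ) := poch_pos (by positivity : 0 < 1 + r) k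
  have hq (k : ℕ) := poch_pos (by positivity : 0 < 1 + r / 2) k
  have hup (n k : ℕ) (hk : k ≤ n) :
      F n k = F (n + 1) k * ((n + 1 - k) * (1 + r + n + k)) := by
    obtain ⟨m, rfl⟩ := Nat.exists_eq_add_of_le hk
    have h1 := (hp (k + m + k)).ne'
    have h2 : 1 + r + (k + m + k : ℕ) ≠ 0 := by positivity
    simp only [hF, Nat.add_sub_cancel_left, show k + m + 1 - k = m + 1 by lia,
      show k + m + 1 + k = k + m + k + 1 by ring, poch_succ (1 + r), Nat.factorial_succ]
    push_cast at *
    field_simp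
    ring
  have hright (n k : ℕ) (hk : k ≤ n) :
      (k + 1) ^ 2 * (1 + r + (n + 1) + k) * F (n + 1) (k + 1)
        = -(r + k) ^ 2 * (n + 1 - k) * F (n + 1) k := by
    obtain ⟨m, rfl⟩ := Nat.exists_eq_add_of_le hk
    have h1 := (hp (k + m + 1 + k)).ne'
    have h2 : 1 + r + (k + m + 1 + k : ℕ) ≠ 0 := by positivity
    simp only [hF, show k + m + 1 - (k + 1) = m by lia, show k + m + 1 - k = m + 1 by lia,
      show k + m + 1 + (k + 1) = k + m + 1 + k + 1 by ring, poch_succ, Nat.factorial_succ, pow_succ]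
    push_cast at *
    field_simp
    ring
  have htel (n : ℕ) : ∀ j ≤ n + 1, ∑ k ∈ Finset.range j,
      ((n + 1) ^ 2 * (1 + r / 2 + n) * F (n + 1) k - (1 - r / 2 + n) * F n k)
      = -(1 / 2) * j ^ 2 * (1 + r + n + j) * F (n + 1) j := by
    intro j hj
    induction j with
    | zero => simp
    | succ k ih =>
      rw [Finset.sum_range_succ, ih (by lia), hup n k (by lia)]
      have := hright n k (by lia)
      push_cast
      linear_combination (1 / 2) * this
  change ∑ k ∈ Finset.range (n + 1), F n k = _
  induction n with
  | zero => simp [hF, poch_zero]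
  | succ n ih =>
    have h := htel n (n + 1) le_rfl
    rw [Finset.sum_sub_distrib, ← Finset.mul_sum, ← Finset.mul_sum, ih] at h
    have h1 := (hq n).ne'
    have h2 : 1 + r / 2 + n ≠ 0 := by positivity
    have h3 : ((n : ℝ) + 1) ^ 2 * (1 + r / 2 + n) ≠ 0 := by positivity
    rw [Finset.sum_range_succ]
    apply mul_left_cancel₀ h3
    push_cast at h
    trans (1 - r / 2 + n) * (poch (1 - r / 2) n / (n.factorial ^ 2 * poch (1 + r / 2) n))
    · linear_combination h
    · simp only [poch_succ, Nat.factorial_succ]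
      push_cast
      field_simp

/-- Summation of the Bailey-type inner series. -/
lemma hasSum_bailey_inner {r : ℝ} (hr : 0 < r) (k : ℕ) :
    HasSum (fun m : ℕ => poch (1 / 2) (k + m) ^ 2 / (m.factorial * poch (1 + r) (k + m + k)))
      (Gamma (1 + r) * Gamma r / Gamma (r + 1 / 2) ^ 2
        * (poch (1 / 2) k ^ 2 / poch (r + 1 / 2) k ^ 2)) := by
  have hk : (0 : ℝ) ≤ k := by positivity
  have h := (hasSum_gaussTerm (a := 1 / 2 + k) (b := 1 / 2 + k) (c := 1 + r + (k + k : ℕ))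
    (by positivity) (by positivity) (by push_cast; linarith)).mul_left
    (poch (1 / 2) k ^ 2 / poch (1 + r) (k + k))
  have h1 := (poch_pos (by positivity : 0 < 1 + r) (k + k)).ne'
  have h2 := (poch_pos (by positivity : 0 < r + 1 / 2) k).ne'
  have h3 := (Gamma_pos_of_pos (by positivity : 0 < r + 1 / 2)).ne'
  convert h using 1
  · rfl
  · funext m
    have h4 := (poch_pos (by positivity : 0 < 1 + r + (k + k : ℕ)) m).ne'
    rw [show k + m + k = k + k + m by ring, poch_add (1 + r), poch_add, gaussTerm]
    field_simp
  · rw [Gamma_add_natCast (by positivity),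
      show 1 + r + ((k + k : ℕ) : ℝ) - (1 / 2 + k) - (1 / 2 + k) = r by push_cast; ring,
      show 1 + r + ((k + k : ℕ) : ℝ) - (1 / 2 + k) = r + 1 / 2 + k by push_cast; ring,
      Gamma_add_natCast (by positivity)]
    field_simp

lemma summable_wellPoised {r : ℝ} (hr0 : 0 < r) (hr1 : r < 1) :
    Summable fun k : ℕ => poch r k ^ 2 / k.factorial ^ 2
      * (poch (1 / 2) k ^ 2 / poch (r + 1 / 2) k ^ 2) := by
  refine (summable_and_tendsto_of_raabe (ε := 1 / 2) (N := 5) (fun n => by positivity)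
    (by norm_num) fun k hk => ?_).1
  have hk' : (5 : ℝ) ≤ k := by exact_mod_cast hk
  have h1 := (poch_pos (by positivity : 0 < r + 1 / 2) k).ne'
  have hd : 0 < r + 1 / 2 + k := by positivity
  set q : ℝ := r / 2 / (r + 1 / 2 + k) with hq
  have hq0 : 0 ≤ q := by positivity
  have hqk : k * q ≤ 1 / 2 := by
    rw [hq, mul_div_assoc', div_le_iff₀ hd]
    nlinarith
  have hq1 : q ≤ 1 := by
    rw [hq, div_le_iff₀ hd]
    linarith
  have hstep : (k + 1) * (poch r (k + 1) ^ 2 / (k + 1).factorial ^ 2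
      * (poch (1 / 2) (k + 1) ^ 2 / poch (r + 1 / 2) (k + 1) ^ 2))
      = poch r k ^ 2 / k.factorial ^ 2 * (poch (1 / 2) k ^ 2 / poch (r + 1 / 2) k ^ 2)
        * ((k + q) ^ 2 / (k + 1)) := by
    have hkq : (k : ℝ) + q = (r + k) * (1 / 2 + k) / (r + 1 / 2 + k) := by
      rw [hq]
      field_simp
      ring
    rw [hkq]
    simp only [poch_succ, Nat.factorial_succ]
    push_cast
    field_simp
  rw [hstep, mul_comm, mul_comm (k : ℝ), ← mul_sub]
  refine mul_le_mul_of_nonneg_left ?_ (by positivity)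
  rw [le_sub_iff_add_le, ← le_sub_iff_add_le', div_le_iff₀ (by positivity)]
  nlinarith

lemma tsum_prod_eq_tsum_sum_range {f : ℕ × ℕ → ℝ} (hf : Summable f) :
    ∑' p, f p = ∑' n : ℕ, ∑ k ∈ Finset.range (n + 1), f (k, n - k) := by
  have h : Summable fun x : Σ n : ℕ, Finset.HasAntidiagonal.antidiagonal n => f (x.2 : ℕ × ℕ) :=
    Finset.HasAntidiagonal.sigmaAntidiagonalEquivProd.summable_iff.2 hf
  rw [← Finset.HasAntidiagonal.sigmaAntidiagonalEquivProd.tsum_eq f]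
  refine (h.tsum_sigma' fun n => (hasSum_fintype _).summable).trans (tsum_congr fun n => ?_)
  rw [tsum_fintype, ← Finset.Nat.sum_antidiagonal_eq_sum_range_succ_mk]
  exact Finset.sum_coe_sort (Finset.HasAntidiagonal.antidiagonal n) f

/-- Whipple's transformation of a well-poised `₄F₃(-1)` into a `₃F₂(1)`, in the case at hand. -/
lemma F43_eq_F32 {r : ℝ} (hr0 : 0 < r) (hr1 : r < 1) :
    Gamma (1 + r) * Gamma r / Gamma (r + 1 / 2) ^ 2
        * F43 r r (1/2) (1/2) 1 (r + 1/2) (r + 1/2) (-1)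
      = F32 (1/2) (1/2) (1 - r/2) 1 (1 + r/2) 1 := by
  set K := Gamma (1 + r) * Gamma r / Gamma (r + 1 / 2) ^ 2
  set A : ℕ → ℝ := fun k => poch r k ^ 2 / k.factorial ^ 2 with hA
  set D : ℕ → ℕ → ℝ := fun k m =>
    poch (1 / 2) (k + m) ^ 2 / (m.factorial * poch (1 + r) (k + m + k)) with hD
  have hin (k : ℕ) := hasSum_bailey_inner hr0 k
  have hA0 (k : ℕ) : 0 ≤ A k := by positivity
  have hD0 (k m : ℕ) : 0 ≤ D k m := by
    have := poch_pos (by positivity : 0 < 1 + r) (k + m + k)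
    positivity
  have habs : Summable fun p : ℕ × ℕ => A p.1 * D p.1 p.2 := by
    refine (summable_prod_of_nonneg fun p => mul_nonneg (hA0 _) (hD0 _ _)).2
      ⟨fun k => (hin k).summable.mul_left (A k), ?_⟩
    refine ((summable_wellPoised hr0 hr1).mul_left K).congr fun k => ?_
    rw [((hin k).mul_left (A k)).tsum_eq]
    ring
  have hsum : Summable fun p : ℕ × ℕ => (-1) ^ p.1 * (A p.1 * D p.1 p.2) :=
    .of_norm <| by simpa [abs_mul, abs_of_nonneg, hA0, hD0] using habs
  have hleft : ∑' p : ℕ × ℕ, (-1) ^ p.1 * (A p.1 * D p.1 p.2)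
      = K * F43 r r (1/2) (1/2) 1 (r + 1/2) (r + 1/2) (-1) := by
    rw [hsum.tsum_prod, F43, ← tsum_mul_left]
    refine tsum_congr fun k => ?_
    rw [(((hin k).mul_left (A k)).mul_left ((-1) ^ k)).tsum_eq, poch_one]
    simp only [hA]
    ring
  rw [← hleft, tsum_prod_eq_tsum_sum_range hsum, F32]
  refine tsum_congr fun n => ?_
  have hdix := dixon_terminating hr0 n
  rw [poch_one, one_pow, mul_one]
  trans poch (1 / 2) n ^ 2 * (poch (1 - r / 2) n / (n.factorial ^ 2 * poch (1 + r / 2) n))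
  · rw [← hdix, Finset.mul_sum]
    refine Finset.sum_congr rfl fun k hk => ?_
    have hk' : k + (n - k) = n := by
      have := Finset.mem_range.1 hk
      lia
    simp only [hA, hD, hk']
    field_simp
  · ring

/-- The well-poised `₄F₃(−1)` period identity for the datum `HD₄(r)`. -/
theorem wellPoised_4F3_period (r : ℝ) (hr0 : 0 < r) (hr1 : r < 1) :
    betaR r (1 - r) * betaR (1/2) r ^ 2
        * F43 r r (1/2) (1/2) 1 (r + 1/2) (r + 1/2) (-1)
      = (2 : ℝ) ^ (-(2 * r)) * betaR ((1 - r)/2) r * betaR (1/2) (1/2) * betaR (1 - r/2) r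
        * F32 (1/2) (1/2) (1 - r/2) 1 (1 + r/2) 1 := by
  rw [← F43_eq_F32 hr0 hr1]
  have d1 := Real.Gamma_mul_Gamma_add_half ((1 - r) / 2)
  have d2 := Real.Gamma_mul_Gamma_add_half ((1 + r) / 2)
  rw [show (1 - r) / 2 + 1 / 2 = 1 - r / 2 by ring, show 2 * ((1 - r) / 2) = 1 - r by ring,
    show 1 - (1 - r) = r by ring] at d1
  rw [show (1 + r) / 2 + 1 / 2 = 1 + r / 2 by ring, show 2 * ((1 + r) / 2) = 1 + r by ring,
    show 1 - (1 + r) = -r by ring] at d2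
  have hpow : (2 : ℝ) ^ (-(2 * r)) * 2 ^ r = 2 ^ (-r) := by
    rw [← rpow_add (by norm_num)]
    ring_nf
  have g1 := (Gamma_pos_of_pos (by positivity : 0 < (1 + r) / 2)).ne'
  have g2 := (Gamma_pos_of_pos (by positivity : 0 < 1 + r / 2)).ne'
  have g3 := (Gamma_pos_of_pos (by positivity : 0 < 1 + r)).ne'
  have g4 := (Gamma_pos_of_pos (by positivity : 0 < r + 1 / 2)).ne'
  have hratio : (2 : ℝ) ^ (-(2 * r)) * (Gamma ((1 - r) / 2) * Gamma (1 - r / 2))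
      / (Gamma ((1 + r) / 2) * Gamma (1 + r / 2)) = Gamma (1 - r) / Gamma (1 + r) := by
    rw [div_eq_div_iff (mul_ne_zero g1 g2) g3, d1, d2]
    linear_combination Gamma (1 - r) * √π * Gamma (1 + r) * hpow
  have hcoef : betaR r (1 - r) * betaR (1 / 2) r ^ 2
      = (2 : ℝ) ^ (-(2 * r)) * betaR ((1 - r)/2) r * betaR (1/2) (1/2) * betaR (1 - r/2) r
        * (Gamma (1 + r) * Gamma r / Gamma (r + 1 / 2) ^ 2) := by
    trans (2 : ℝ) ^ (-(2 * r)) * (Gamma ((1 - r) / 2) * Gamma (1 - r / 2))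
      / (Gamma ((1 + r) / 2) * Gamma (1 + r / 2)) * (Gamma (1 / 2) ^ 2 * Gamma r ^ 3
        * Gamma (1 + r) / Gamma (r + 1 / 2) ^ 2)
    · rw [hratio]
      simp only [betaR]
      rw [show r + (1 - r) = 1 by ring, show 1 / 2 + r = r + 1 / 2 by ring, Gamma_one]
      field_simp
    · simp only [betaR]
      rw [show (1 - r) / 2 + r = (1 + r) / 2 by ring, show 1 - r / 2 + r = 1 + r / 2 by ring,
        show (1 / 2 : ℝ) + 1 / 2 = 1 by norm_num, Gamma_one]
      field_simp
  rw [hcoef]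
  ring
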